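/- Let L > 0 and T > 0, and let φ : ℝ² → ℝ be infinitely differentiable with ∂φ/∂x (t, 0) = ∂φ/∂x (t, L) = 0 for all t ∈ [0,T]. Then for all 0 ≤ s < r ≤ T and all y ∈ [0,L], ∫ₛʳ ∫₀ᴸ g(t − s, x, y) · ( ∂φ/∂t (t,x) + ∂²φ/∂x² (t,x) ) dx dt = ∫₀ᴸ g(r − s, x, y) φ(r, x) dx − φ(s, y). -/

import Mathlib

open MeasureTheory Real Set

/-- The one-dimensional heat kernel `p(t,x) = (4πt)^(−1/2) · exp(−x²/(4t))`. -/
noncomputable def heatKernel (t x : ℝ) : ℝ :=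
  (Real.sqrt (4 * Real.pi * t))⁻¹ * Real.exp (-(x ^ 2) / (4 * t))

/-- The Green's function of the heat equation on `[0,L]` with Neumann boundary
conditions. -/
noncomputable def greenNeumann (L t x y : ℝ) : ℝ :=
  ∑' n : ℤ, (heatKernel t (x - y - 2 * (n : ℝ) * L) + heatKernel t (x + y - 2 * (n : ℝ) * L))

lemma summable_cexp_neg_quadratic {a : ℝ} (ha : 0 < a) (b : ℂ) :
    Summable fun n : ℤ => Complex.exp (-a * n ^ 2 + b * n) := by
  have hτ : 0 < (Complex.I * (a / π : ℝ)).im := by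
    simpa using div_pos ha pi_pos
  refine ((summable_jacobiTheta₂_term_iff (-Complex.I * b / (2 * π)) _).2 hτ).congr fun n => ?_
  have hpi : (π : ℂ) ≠ 0 := by exact_mod_cast pi_ne_zero
  rw [jacobiTheta₂_term]
  congr 1
  push_cast
  field_simp
  linear_combination (-(a : ℂ) * n ^ 2 + n * b) * (-Complex.I_sq)

/-- Summability of the Gaussian weights of the cosine modes on an interval of length `L`. -/
lemma summable_exp_neg_freq_sq {L t : ℝ} (hL : 0 < L) (ht : 0 < t) :
    Summable fun n : ℤ => Real.exp (-(n * π / L) ^ 2 * t) := by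
  have ha : 0 < (π / L) ^ 2 * t := by positivity
  refine (summable_cexp_neg_quadratic ha 0).norm.congr fun n => ?_
  rw [Complex.norm_exp]
  congr 1
  rw [zero_mul, add_zero, ← Complex.ofReal_neg, ← Complex.ofReal_intCast, ← Complex.ofReal_pow,
    ← Complex.ofReal_mul, Complex.ofReal_re]
  ring

lemma summable_heatKernel_images {L t : ℝ} (hL : 0 < L) (ht : 0 < t) (z : ℝ) :
    Summable fun n : ℤ => heatKernel t (z - 2 * n * L) := by
  have ha : 0 < L ^ 2 / t := by positivity
  refine Summable.mul_left _ (((summable_cexp_neg_quadratic ha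
    ((z * L / t : ℝ) : ℂ)).norm.mul_left (Real.exp (-(z ^ 2) / (4 * t)))).congr fun n => ?_)
  rw [Complex.norm_exp, ← Real.exp_add]
  congr 1
  rw [← Complex.ofReal_neg, ← Complex.ofReal_intCast, ← Complex.ofReal_pow,
    ← Complex.ofReal_mul, ← Complex.ofReal_mul, ← Complex.ofReal_add, Complex.ofReal_re]
  field_simp
  ring

/-- Poisson summation for the periodized heat kernel. -/
lemma hasSum_tsum_heatKernel_images {L t : ℝ} (hL : 0 < L) (ht : 0 < t) (z : ℝ) :
    HasSum (fun n : ℤ => (2 * L)⁻¹ * (Real.exp (-(n * π / L) ^ 2 * t) * Real.cos (n * π / L * z)))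
      (∑' n : ℤ, heatKernel t (z - 2 * n * L)) := by
  have hpi := pi_pos
  have ha : 0 < π * t / L ^ 2 := by positivity
  have hLC : (L : ℂ) ≠ 0 := by exact_mod_cast hL.ne'
  have htC : (t : ℂ) ≠ 0 := by exact_mod_cast ht.ne'
  have hpC : (π : ℂ) ≠ 0 := by exact_mod_cast hpi.ne'
  have key := Complex.tsum_exp_neg_quadratic (a := (π * t / L ^ 2 : ℝ))
    (by rwa [Complex.ofReal_re]) (Complex.I * z / (2 * L))
  have hs : Summable fun n : ℤ => Complex.exp
      (-π * (π * t / L ^ 2 : ℝ) * n ^ 2 + 2 * π * (Complex.I * z / (2 * L)) * n) := by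
    refine (summable_cexp_neg_quadratic (mul_pos hpi ha)
      (2 * π * (Complex.I * z / (2 * L)))).congr fun n => ?_
    push_cast
    ring_nf
  have hr : ∀ n : ℤ, Complex.exp (-π / (π * t / L ^ 2 : ℝ) * (n + Complex.I *
      (Complex.I * z / (2 * L))) ^ 2) = ((Real.exp (-((z - 2 * n * L) ^ 2) / (4 * t)) : ℝ) : ℂ) := by
    intro n
    rw [Complex.ofReal_exp, ← mul_div_assoc, ← mul_assoc, Complex.I_mul_I]
    congr 1
    push_cast
    field_simp
    ring
  simp_rw [hr] at key
  rw [show (1 / 2 : ℂ) = ((1 / 2 : ℝ) : ℂ) by norm_num, ← Complex.ofReal_cpow ha.le,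
    ← Real.sqrt_eq_rpow, ← Complex.ofReal_tsum, ← Complex.ofReal_one, ← Complex.ofReal_div,
    ← Complex.ofReal_mul] at key
  have h := hs.hasSum
  rw [key] at h
  have h' := (Complex.hasSum_re h).mul_left (2 * L)⁻¹
  rw [Complex.ofReal_re] at h'
  have hv : ∑' n : ℤ, heatKernel t (z - 2 * n * L) = (2 * L)⁻¹ * (1 / √(π * t / L ^ 2) *
      ∑' n : ℤ, Real.exp (-((z - 2 * n * L) ^ 2) / (4 * t))) := by
    simp only [heatKernel]
    rw [tsum_mul_left, ← mul_assoc]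
    congr 1
    rw [Real.sqrt_div (by positivity), Real.sqrt_sq hL.le, mul_assoc,
      Real.sqrt_mul (by norm_num), show (4 : ℝ) = 2 ^ 2 by norm_num, Real.sqrt_sq (by norm_num)]
    have : √(π * t) ≠ 0 := (Real.sqrt_pos.2 (by positivity)).ne'
    field_simp
  rw [hv]
  refine h'.congr_fun fun n => ?_
  have : (-π * (π * t / L ^ 2 : ℝ) * n ^ 2 + 2 * π * (Complex.I * z / (2 * L)) * n : ℂ)
      = ((-(n * π / L) ^ 2 * t : ℝ) : ℂ) + ((n * π / L * z : ℝ) : ℂ) * Complex.I := by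
    push_cast
    field_simp
  rw [this, Complex.exp_add, ← Complex.ofReal_exp, Complex.re_ofReal_mul,
    Complex.exp_ofReal_mul_I_re]

/-- The cosine expansion of the Neumann Green's function. -/
lemma hasSum_greenNeumann {L t : ℝ} (hL : 0 < L) (ht : 0 < t) (x y : ℝ) :
    HasSum (fun n : ℤ => L⁻¹ * Real.exp (-(n * π / L) ^ 2 * t) * Real.cos (n * π / L * y)
      * Real.cos (n * π / L * x)) (greenNeumann L t x y) := by
  have h := (hasSum_tsum_heatKernel_images hL ht (x - y)).add (hasSum_tsum_heatKernel_images hL ht (x + y))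
  rw [← (summable_heatKernel_images hL ht (x - y)).tsum_add
    (summable_heatKernel_images hL ht (x + y))] at h
  refine h.congr_fun fun n => ?_
  rw [mul_sub, mul_add, Real.cos_sub, Real.cos_add]
  field_simp
  ring

lemma summable_inv_freq_sq (L : ℝ) : Summable fun n : ℤ => ((n * π / L) ^ 2)⁻¹ := by
  refine ((Real.summable_one_div_int_pow.2 one_lt_two).mul_left ((π / L) ^ 2)⁻¹).congr fun n => ?_
  rw [one_div, ← mul_inv, ← mul_pow]
  congr 2
  ring

lemma eventually_cofinite_int_ne_zero : ∀ᶠ n : ℤ in Filter.cofinite, n ≠ 0 := by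
  simpa using (Set.finite_singleton (0 : ℤ)).eventually_cofinite_notMem

lemma hasSum_integral_greenNeumann_mul {L t : ℝ} (hL : 0 < L) (ht : 0 < t) (y : ℝ) {f : ℝ → ℝ}
    (hf : Continuous f) :
    HasSum (fun n : ℤ => L⁻¹ * Real.cos (n * π / L * y) * (Real.exp (-(n * π / L) ^ 2 * t) *
      ∫ x in (0 : ℝ)..L, Real.cos (n * π / L * x) * f x))
      (∫ x in Ioc 0 L, greenNeumann L t x y * f x) := by
  have hint : ∀ {u : ℝ → ℝ}, Continuous u → Integrable u (volume.restrict (Ioc 0 L)) := fun hu =>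
    (hu.continuousOn.integrableOn_Icc).mono_set Ioc_subset_Icc_self
  have h := hasSum_integral_of_summable_integral_norm (μ := volume.restrict (Ioc 0 L))
    (F := fun (n : ℤ) x => L⁻¹ * Real.cos (n * π / L * y) * (Real.exp (-(n * π / L) ^ 2 * t) *
      (Real.cos (n * π / L * x) * f x))) (fun n => hint (by fun_prop)) ?_
  · have hv : ∀ x, ∑' n : ℤ, L⁻¹ * Real.cos (n * π / L * y) * (Real.exp (-(n * π / L) ^ 2 * t) *
        (Real.cos (n * π / L * x) * f x)) = greenNeumann L t x y * f x := fun x =>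
      (((hasSum_greenNeumann hL ht x y).mul_right (f x)).congr_fun fun n => by ring).tsum_eq
    simp_rw [hv] at h
    refine h.congr_fun fun n => ?_
    rw [intervalIntegral.integral_of_le hL.le, ← integral_const_mul, ← integral_const_mul]
  · refine ((summable_exp_neg_freq_sq hL ht).mul_right (L⁻¹ * ∫ x in Ioc 0 L, |f x|)).of_nonneg_of_le
      (fun n => integral_nonneg fun x => norm_nonneg _) fun n => ?_
    rw [← mul_assoc, ← integral_const_mul]
    refine integral_mono (hint (by fun_prop)) (hint (by fun_prop)) fun x => ?_
    simp only [norm_mul, Real.norm_eq_abs, Real.abs_exp, abs_inv, abs_of_pos hL]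
    calc L⁻¹ * |Real.cos (n * π / L * y)| * (Real.exp (-(n * π / L) ^ 2 * t) *
        (|Real.cos (n * π / L * x)| * |f x|))
      _ ≤ L⁻¹ * 1 * (Real.exp (-(n * π / L) ^ 2 * t) * (1 * |f x|)) := by
        gcongr <;> exact Real.abs_cos_le_one _
      _ = _ := by ring

/-- Two integrations by parts against a cosine mode, under Neumann boundary conditions. -/
lemma integral_cos_mul_deriv2 {L : ℝ} (hL : L ≠ 0) (n : ℤ) {f f' f'' : ℝ → ℝ}
    (hf : ∀ x, HasDerivAt f (f' x) x) (hf' : ∀ x, HasDerivAt f' (f'' x) x) (hf'' : Continuous f'')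
    (h0 : f' 0 = 0) (h1 : f' L = 0) :
    ∫ x in (0 : ℝ)..L, Real.cos (n * π / L * x) * f'' x =
      -(n * π / L) ^ 2 * ∫ x in (0 : ℝ)..L, Real.cos (n * π / L * x) * f x := by
  have hc' : Continuous f' := continuous_iff_continuousAt.2 fun x => (hf' x).continuousAt
  set w := n * π / L with hw
  have hwL : Real.sin (w * L) = 0 := by
    rw [hw, div_mul_cancel₀ _ hL, Real.sin_int_mul_pi]
  have dm : ∀ x, HasDerivAt (fun x => w * x) w x := fun x => by
    simpa using (hasDerivAt_id x).const_mul w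
  have dc : ∀ x, HasDerivAt (fun x => Real.cos (w * x)) (-Real.sin (w * x) * w) x :=
    fun x => (dm x).cos
  have ds : ∀ x, HasDerivAt (fun x => Real.sin (w * x)) (Real.cos (w * x) * w) x :=
    fun x => (dm x).sin
  rw [intervalIntegral.integral_mul_deriv_eq_deriv_mul (fun x _ => dc x) (fun x _ => hf' x)
    ((by fun_prop : Continuous _).intervalIntegrable _ _) (hf''.intervalIntegrable _ _)]
  have e1 : ∀ x, -Real.sin (w * x) * w * f' x = -w * (Real.sin (w * x) * f' x) := fun x => by ring
  have e2 : ∀ x, Real.cos (w * x) * w * f x = w * (Real.cos (w * x) * f x) := fun x => by ring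
  simp_rw [e1]
  rw [intervalIntegral.integral_const_mul,
    intervalIntegral.integral_mul_deriv_eq_deriv_mul (fun x _ => ds x) (fun x _ => hf x)
    ((by fun_prop : Continuous _).intervalIntegrable _ _) (hc'.intervalIntegrable _ _)]
  simp_rw [e2]
  rw [intervalIntegral.integral_const_mul, hwL, h0, h1, mul_zero w, Real.sin_zero]
  ring

lemma abs_integral_cos_mul_le {L M : ℝ} (hL : 0 ≤ L) (w : ℝ) {f : ℝ → ℝ}
    (hf : ∀ x ∈ Icc 0 L, |f x| ≤ M) :
    |∫ x in (0 : ℝ)..L, Real.cos (w * x) * f x| ≤ M * L := by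
  have := intervalIntegral.norm_integral_le_of_norm_le_const (a := 0) (b := L) (C := M)
    (f := fun x => Real.cos (w * x) * f x) fun x hx => by
      rw [uIoc_of_le hL] at hx
      rw [norm_mul, Real.norm_eq_abs, Real.norm_eq_abs]
      exact (mul_le_of_le_one_left (abs_nonneg _) (Real.abs_cos_le_one _)).trans
        (hf x (Ioc_subset_Icc_self hx))
  rwa [sub_zero, abs_of_nonneg hL, Real.norm_eq_abs] at this

lemma summable_integral_cos_mul {L : ℝ} (hL : 0 < L) {f f' f'' : ℝ → ℝ}
    (hf : ∀ x, HasDerivAt f (f' x) x) (hf' : ∀ x, HasDerivAt f' (f'' x) x) (hf'' : Continuous f'')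
    (h0 : f' 0 = 0) (h1 : f' L = 0) :
    Summable fun n : ℤ => ∫ x in (0 : ℝ)..L, Real.cos (n * π / L * x) * f x := by
  obtain ⟨M, hM⟩ := isCompact_Icc.exists_bound_of_continuousOn (s := Icc 0 L) hf''.continuousOn
  refine ((summable_inv_freq_sq L).mul_right (M * L)).of_norm_bounded_eventually ?_
  filter_upwards [eventually_cofinite_int_ne_zero] with n hn
  have hw : 0 < (n * π / L) ^ 2 := by
    have : (n : ℝ) ≠ 0 := by exact_mod_cast hn
    have := pi_pos
    positivity
  have h := abs_integral_cos_mul_le hL.le (n * π / L) hM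
  rw [integral_cos_mul_deriv2 hL.ne' n hf hf' hf'' h0 h1, abs_mul, abs_neg, abs_of_pos hw] at h
  rwa [Real.norm_eq_abs, le_inv_mul_iff₀ hw]

/-- A continuous function on `[0, L]` with summable cosine coefficients is the sum of its cosine
series. -/
lemma hasSum_cosine_series {L : ℝ} (hL : 0 < L) {f : ℝ → ℝ} (hf : Continuous f)
    (hs : Summable fun n : ℤ => ∫ x in (0 : ℝ)..L, Real.cos (n * π / L * x) * f x)
    {y : ℝ} (hy : y ∈ Icc 0 L) :
    HasSum (fun n : ℤ => L⁻¹ * Real.cos (n * π / L * y) *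
      ∫ x in (0 : ℝ)..L, Real.cos (n * π / L * x) * f x) (f y) := by
  have : Fact (0 < 2 * L) := ⟨by positivity⟩
  have hLC : (L : ℂ) ≠ 0 := by exact_mod_cast hL.ne'
  have hend : -L + 2 * L = L := by ring
  let F : ℝ → ℂ := fun x => (f |x| : ℂ)
  have hF : Continuous F := by fun_prop
  have hFL : F (-L) = F (-L + 2 * L) := by simp [F, hend]
  let G : C(AddCircle (2 * L), ℂ) :=
    ⟨AddCircle.liftIco (2 * L) (-L) F, AddCircle.liftIco_continuous hFL hF.continuousOn⟩
  have hG : ∀ x ∈ Icc (-L) L, G (x : AddCircle (2 * L)) = F x := by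
    intro x hx
    rcases hx.2.lt_or_eq with h | rfl
    · exact AddCircle.liftIco_coe_apply (f := F) ⟨hx.1, by rwa [hend]⟩
    · have : ((x : ℝ) : AddCircle (2 * x)) = ((-x : ℝ) : AddCircle (2 * x)) := by
        rw [← AddCircle.coe_add_period (2 * x) (-x), hend]
      rw [this]
      refine (AddCircle.liftIco_coe_apply (f := F) ⟨le_rfl, by linarith⟩).trans ?_
      simp [F]
  have hcoeff : ∀ n : ℤ, fourierCoeff G n =
      ((L⁻¹ * ∫ x in (0 : ℝ)..L, Real.cos (n * π / L * x) * f x : ℝ) : ℂ) := by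
    intro n
    rw [fourierCoeff_eq_intervalIntegral G n (-L), hend]
    have hexp : ∀ x : ℝ, (fourier (-n) (x : AddCircle (2 * L)) : ℂ)
        = Complex.exp (-((n * π / L * x : ℝ) : ℂ) * Complex.I) := by
      intro x
      rw [fourier_coe_apply]
      congr 1
      push_cast
      field_simp
    have e : ∫ x in (-L)..L, fourier (-n) (x : AddCircle (2 * L)) • G (x : AddCircle (2 * L)) =
        ∫ x in (-L)..L, Complex.exp (-((n * π / L * x : ℝ) : ℂ) * Complex.I) * F x := by
      refine intervalIntegral.integral_congr fun x hx => ?_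
      rw [uIcc_of_le (by linarith)] at hx
      simp only [hG x hx, hexp, smul_eq_mul]
    have hc : Continuous fun x : ℝ =>
        Complex.exp (-((n * π / L * x : ℝ) : ℂ) * Complex.I) * F x := by fun_prop
    have hc' : Continuous fun x : ℝ =>
        Complex.exp (-((n * π / L * -x : ℝ) : ℂ) * Complex.I) * F (-x) := by fun_prop
    rw [e, ← intervalIntegral.integral_add_adjacent_intervals (hc.intervalIntegrable (-L) 0)
      (hc.intervalIntegrable 0 L)]
    have hneg := intervalIntegral.integral_comp_neg (a := 0) (b := L) fun x : ℝ =>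
        Complex.exp (-((n * π / L * x : ℝ) : ℂ) * Complex.I) * F x
    rw [neg_zero] at hneg
    rw [← hneg, ← intervalIntegral.integral_add (hc'.intervalIntegrable 0 L)
      (hc.intervalIntegrable 0 L), Complex.ofReal_mul, ← intervalIntegral.integral_ofReal,
      ← intervalIntegral.integral_const_mul]
    rw [← intervalIntegral.integral_smul]
    refine intervalIntegral.integral_congr fun x hx => ?_
    rw [uIcc_of_le hL.le] at hx
    simp only [F, abs_neg, abs_of_nonneg hx.1, Complex.ofReal_mul, Complex.ofReal_cos,
      Complex.cos, Complex.real_smul]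
    push_cast
    field_simp
  have hsum : Summable (fourierCoeff G) := by
    rw [funext hcoeff]
    exact_mod_cast (hs.mul_left L⁻¹)
  have h := Complex.hasSum_re (has_pointwise_sum_fourier_series_of_summable hsum y)
  rw [hG y ⟨by linarith [hy.1], hy.2⟩] at h
  simp only [F, abs_of_nonneg hy.1, Complex.ofReal_re] at h
  refine h.congr_fun fun n => ?_
  rw [hcoeff, smul_eq_mul, Complex.re_ofReal_mul, fourier_coe_apply,
    show (2 * π * Complex.I * n * y / (2 * L : ℝ) : ℂ) = ((n * π / L * y : ℝ) : ℂ) * Complex.I by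
      push_cast
      field_simp, Complex.exp_ofReal_mul_I_re]
  ring

/-- The duality identity tested against a single cosine mode. -/
lemma integral_exp_mul_integral_cos_mul {L : ℝ} (hL : 0 < L) (n : ℤ) {s r : ℝ} (hsr : s ≤ r)
    {φ φt φx φxx : ℝ → ℝ → ℝ}
    (hφ : Continuous φ.uncurry) (hφt : Continuous φt.uncurry) (hφxx : Continuous φxx.uncurry)
    (dt : ∀ t x, HasDerivAt (fun τ => φ τ x) (φt t x) t)
    (dx : ∀ t x, HasDerivAt (φ t) (φx t x) x)
    (dxx : ∀ t x, HasDerivAt (φx t) (φxx t x) x)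
    (hbc : ∀ t ∈ Icc s r, φx t 0 = 0 ∧ φx t L = 0) :
    ∫ t in s..r, Real.exp (-(n * π / L) ^ 2 * (t - s)) *
        ∫ x in (0 : ℝ)..L, Real.cos (n * π / L * x) * (φt t x + φxx t x) =
      Real.exp (-(n * π / L) ^ 2 * (r - s)) *
        (∫ x in (0 : ℝ)..L, Real.cos (n * π / L * x) * φ r x) -
        ∫ x in (0 : ℝ)..L, Real.cos (n * π / L * x) * φ s x := by
  have c0 : Continuous fun p : ℝ × ℝ => φ p.1 p.2 := hφ
  have ct : Continuous fun p : ℝ × ℝ => φt p.1 p.2 := hφt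
  have cxx : Continuous fun p : ℝ × ℝ => φxx p.1 p.2 := hφxx
  have slice : ∀ {u : ℝ → ℝ → ℝ}, Continuous (fun p : ℝ × ℝ => u p.1 p.2) → ∀ t,
      Continuous (u t) := fun hu t => hu.comp (Continuous.prodMk_right t)
  set w := n * π / L with hw
  let k : ℝ → ℝ → ℝ := fun t x =>
    Real.cos (w * x) * (Real.exp (-w ^ 2 * (t - s)) * (φt t x - w ^ 2 * φ t x))
  have ck : Continuous k.uncurry := by
    change Continuous fun p : ℝ × ℝ => Real.cos (w * p.2) *
      (Real.exp (-w ^ 2 * (p.1 - s)) * (φt p.1 p.2 - w ^ 2 * φ p.1 p.2))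
    fun_prop
  have e : ∀ t ∈ uIcc s r, Real.exp (-w ^ 2 * (t - s)) *
      (∫ x in (0 : ℝ)..L, Real.cos (w * x) * (φt t x + φxx t x)) = ∫ x in (0 : ℝ)..L, k t x := by
    intro t ht
    rw [uIcc_of_le hsr] at ht
    have c1 := slice c0 t
    have c2 := slice ct t
    have c3 := slice cxx t
    have ibp := integral_cos_mul_deriv2 hL.ne' n (dx t) (dxx t) c3 (hbc t ht).1 (hbc t ht).2
    rw [← hw] at ibp
    have i1 : IntervalIntegrable (fun x => Real.cos (w * x) * φt t x) volume 0 L :=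
      (by fun_prop : Continuous _).intervalIntegrable _ _
    have i2 : IntervalIntegrable (fun x => Real.cos (w * x) * φxx t x) volume 0 L :=
      (by fun_prop : Continuous _).intervalIntegrable _ _
    have i3 : IntervalIntegrable (fun x => -w ^ 2 * (Real.cos (w * x) * φ t x)) volume 0 L :=
      (by fun_prop : Continuous _).intervalIntegrable _ _
    simp_rw [mul_add]
    rw [intervalIntegral.integral_add i1 i2, ibp, ← intervalIntegral.integral_const_mul,
      ← intervalIntegral.integral_add i1 i3, ← intervalIntegral.integral_const_mul]
    refine intervalIntegral.integral_congr fun x _ => ?_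
    simp only [k]
    ring
  rw [intervalIntegral.integral_congr e, intervalIntegral_intervalIntegral_swap
    ((ck.continuousOn.integrableOn_compact (isCompact_uIcc.prod isCompact_uIcc)).mono_set
      (prod_mono uIoc_subset_uIcc uIoc_subset_uIcc))]
  have ftc : ∀ x, ∫ t in s..r, k t x = Real.exp (-w ^ 2 * (r - s)) * (Real.cos (w * x) * φ r x) -
      Real.cos (w * x) * φ s x := by
    intro x
    have d : ∀ t, HasDerivAt (fun t => Real.cos (w * x) * (Real.exp (-w ^ 2 * (t - s)) * φ t x))
        (k t x) t := by
      intro t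
      have d1 : HasDerivAt (fun t => Real.exp (-w ^ 2 * (t - s)))
          (Real.exp (-w ^ 2 * (t - s)) * (-w ^ 2)) t := by
        simpa using (((hasDerivAt_id t).sub_const s).const_mul (-w ^ 2)).exp
      refine ((d1.mul (dt t x)).const_mul (Real.cos (w * x))).congr_deriv ?_
      simp only [k]
      ring
    rw [intervalIntegral.integral_eq_sub_of_hasDerivAt (fun t _ => d t)
      ((ck.comp (Continuous.prodMk_left x)).intervalIntegrable _ _)]
    simp only [sub_self, mul_zero, Real.exp_zero]
    ring
  simp_rw [ftc]
  have cr := slice c0 r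
  have cs := slice c0 s
  rw [intervalIntegral.integral_sub ((by fun_prop : Continuous _).intervalIntegrable _ _)
    ((by fun_prop : Continuous _).intervalIntegrable _ _), intervalIntegral.integral_const_mul]

lemma integral_exp_neg_mul_le {c : ℝ} (hc : 0 < c) (s r : ℝ) :
    ∫ t in s..r, Real.exp (-c * (t - s)) ≤ c⁻¹ := by
  have d : ∀ t, HasDerivAt (fun t => -c⁻¹ * Real.exp (-c * (t - s))) (Real.exp (-c * (t - s))) t := by
    intro t
    refine ((((hasDerivAt_id t).sub_const s).const_mul (-c)).exp.const_mul (-c⁻¹)).congr_deriv ?_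
    simp only [id_eq]
    field_simp
  rw [intervalIntegral.integral_eq_sub_of_hasDerivAt (fun t _ => d t)
    ((by fun_prop : Continuous _).intervalIntegrable _ _)]
  have : 0 < c⁻¹ * Real.exp (-c * (r - s)) := by positivity
  simp only [sub_self, mul_zero, Real.exp_zero]
  linarith

lemma hasSum_integral_integral_greenNeumann_mul {L : ℝ} (hL : 0 < L) {s r : ℝ} (hsr : s ≤ r)
    (y : ℝ) {h : ℝ → ℝ → ℝ} (hh : Continuous h.uncurry) :
    HasSum (fun n : ℤ => L⁻¹ * Real.cos (n * π / L * y) *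
      ∫ t in s..r, Real.exp (-(n * π / L) ^ 2 * (t - s)) *
        ∫ x in (0 : ℝ)..L, Real.cos (n * π / L * x) * h t x)
      (∫ t in Ioc s r, ∫ x in Ioc 0 L, greenNeumann L (t - s) x y * h t x) := by
  have ch : Continuous fun p : ℝ × ℝ => h p.1 p.2 := hh
  have hint : ∀ {u : ℝ → ℝ}, Continuous u → Integrable u (volume.restrict (Ioc s r)) := fun hu =>
    (hu.continuousOn.integrableOn_Icc).mono_set Ioc_subset_Icc_self
  obtain ⟨M, hM⟩ := (isCompact_Icc (a := s) (b := r)).prod (isCompact_Icc (a := 0) (b := L))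
    |>.exists_bound_of_continuousOn hh.continuousOn
  let H : ℤ → ℝ → ℝ := fun n t => ∫ x in (0 : ℝ)..L, Real.cos (n * π / L * x) * h t x
  have cH : ∀ n, Continuous (H n) := fun n =>
    intervalIntegral.continuous_parametric_intervalIntegral_of_continuous'
      (f := fun t x => Real.cos (n * π / L * x) * h t x)
      (by change Continuous fun p : ℝ × ℝ => Real.cos (n * π / L * p.2) * h p.1 p.2; fun_prop) 0 L
  have bH : ∀ n, ∀ t ∈ Icc s r, |H n t| ≤ M * L := fun n t ht =>
    abs_integral_cos_mul_le hL.le _ fun x hx => hM (t, x) ⟨ht, hx⟩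
  have key := hasSum_integral_of_summable_integral_norm (μ := volume.restrict (Ioc s r))
    (F := fun (n : ℤ) t => L⁻¹ * Real.cos (n * π / L * y) *
      (Real.exp (-(n * π / L) ^ 2 * (t - s)) * H n t))
    (fun n => hint (by have := cH n; fun_prop)) ?_
  · have hv : ∀ t ∈ Ioc s r, ∑' n : ℤ, L⁻¹ * Real.cos (n * π / L * y) *
        (Real.exp (-(n * π / L) ^ 2 * (t - s)) * H n t) =
        ∫ x in Ioc 0 L, greenNeumann L (t - s) x y * h t x := fun t ht =>
      (hasSum_integral_greenNeumann_mul hL (sub_pos.2 ht.1) y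
        (ch.comp (Continuous.prodMk_right t))).tsum_eq
    rw [setIntegral_congr_fun measurableSet_Ioc hv] at key
    refine key.congr_fun fun n => ?_
    rw [intervalIntegral.integral_of_le hsr, ← integral_const_mul]
  · refine ((summable_inv_freq_sq L).mul_left (L⁻¹ * (M * L))).of_norm_bounded_eventually ?_
    filter_upwards [eventually_cofinite_int_ne_zero] with n hn
    have hw : 0 < (n * π / L) ^ 2 := by
      have : (n : ℝ) ≠ 0 := by exact_mod_cast hn
      have := pi_pos
      positivity
    rw [Real.norm_of_nonneg (integral_nonneg fun t => norm_nonneg _)]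
    have cHn := cH n
    calc ∫ t in Ioc s r, ‖L⁻¹ * Real.cos (n * π / L * y) *
          (Real.exp (-(n * π / L) ^ 2 * (t - s)) * H n t)‖
      _ ≤ ∫ t in Ioc s r, L⁻¹ * (M * L) * Real.exp (-(n * π / L) ^ 2 * (t - s)) := by
        refine setIntegral_mono_on (hint (by fun_prop)) (hint (by fun_prop)) measurableSet_Ioc
          fun t ht => ?_
        have := bH n t (Ioc_subset_Icc_self ht)
        simp only [norm_mul, Real.norm_eq_abs, Real.abs_exp, abs_inv, abs_of_pos hL]
        calc L⁻¹ * |Real.cos (n * π / L * y)| *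
              (Real.exp (-(n * π / L) ^ 2 * (t - s)) * |H n t|)
          _ ≤ L⁻¹ * 1 * (Real.exp (-(n * π / L) ^ 2 * (t - s)) * (M * L)) := by
            gcongr
            exact Real.abs_cos_le_one _
          _ = _ := by ring
      _ ≤ L⁻¹ * (M * L) * ((n * π / L) ^ 2)⁻¹ := by
        rw [integral_const_mul, ← intervalIntegral.integral_of_le hsr]
        have hM0 : 0 ≤ M * L := (abs_nonneg _).trans (bH 0 s ⟨le_rfl, hsr⟩)
        gcongr
        exact integral_exp_neg_mul_le hw s r

/-- Let `L, T > 0` and let `φ : ℝ² → ℝ` be smooth with `∂φ/∂x (t,0) = ∂φ/∂x (t,L) = 0`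
for all `t ∈ [0,T]`.  Then for all `0 ≤ s < r ≤ T` and `y ∈ [0,L]`,
`∫ₛʳ ∫₀ᴸ g(t − s, x, y)(∂φ/∂t (t,x) + ∂²φ/∂x² (t,x)) dx dt
  = ∫₀ᴸ g(r − s, x, y) φ(r,x) dx − φ(s,y)`. -/
theorem greenNeumann_duality (L T : ℝ) (hL : 0 < L) (hT : 0 < T)
    (φ : ℝ × ℝ → ℝ) (hφ : ContDiff ℝ (⊤ : ℕ∞) φ)
    (hbc : ∀ t ∈ Set.Icc (0 : ℝ) T,
      deriv (fun ξ => φ (t, ξ)) 0 = 0 ∧ deriv (fun ξ => φ (t, ξ)) L = 0)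
    (s r : ℝ) (hs : 0 ≤ s) (hsr : s < r) (hrT : r ≤ T)
    (y : ℝ) (hy : y ∈ Set.Icc (0 : ℝ) L) :
    ∫ t in Set.Ioc s r, ∫ x in Set.Ioc (0 : ℝ) L,
        greenNeumann L (t - s) x y *
          (deriv (fun τ => φ (τ, x)) t + deriv (fun ξ => deriv (fun ξ' => φ (t, ξ')) ξ) x)
      = (∫ x in Set.Ioc (0 : ℝ) L, greenNeumann L (r - s) x y * φ (r, x)) - φ (s, y) := by
  have h1 : ContDiff ℝ 1 (fderiv ℝ φ) := hφ.fderiv_right (by norm_cast)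
  have dφ : ∀ p, HasFDerivAt φ (fderiv ℝ φ p) p := fun p =>
    (hφ.differentiable (by simp) p).hasFDerivAt
  let φt : ℝ → ℝ → ℝ := fun t x => fderiv ℝ φ (t, x) (1, 0)
  let ψ : ℝ × ℝ → ℝ := fun p => fderiv ℝ φ p (0, 1)
  let φxx : ℝ → ℝ → ℝ := fun t x => fderiv ℝ ψ (t, x) (0, 1)
  have hψ : ContDiff ℝ 1 ψ := h1.clm_apply contDiff_const
  have line_t : ∀ t x : ℝ, HasDerivAt (fun τ : ℝ => (τ, x)) ((1, 0) : ℝ × ℝ) t := fun t x =>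
    (hasDerivAt_id t).prodMk (hasDerivAt_const t x)
  have line_x : ∀ t x : ℝ, HasDerivAt (fun ξ : ℝ => (t, ξ)) ((0, 1) : ℝ × ℝ) x := fun t x =>
    (hasDerivAt_const x t).prodMk (hasDerivAt_id x)
  have dt : ∀ t x, HasDerivAt (fun τ => φ (τ, x)) (φt t x) t := fun t x =>
    (dφ (t, x)).comp_hasDerivAt t (line_t t x)
  have dx : ∀ t x, HasDerivAt (fun ξ => φ (t, ξ)) (ψ (t, x)) x := fun t x =>
    (dφ (t, x)).comp_hasDerivAt x (line_x t x)
  have dxx : ∀ t x, HasDerivAt (fun ξ => ψ (t, ξ)) (φxx t x) x := fun t x =>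
    (hψ.differentiable one_ne_zero (t, x)).hasFDerivAt.comp_hasDerivAt x (line_x t x)
  have cφ : Continuous φ := hφ.continuous
  have ct : Continuous φt.uncurry := (h1.continuous.clm_apply continuous_const :)
  have cxx : Continuous φxx.uncurry :=
    ((hψ.continuous_fderiv one_ne_zero).clm_apply continuous_const :)
  have hbc' : ∀ t ∈ Icc 0 T, ψ (t, 0) = 0 ∧ ψ (t, L) = 0 := fun t ht =>
    ⟨(dx t 0).deriv ▸ (hbc t ht).1, (dx t L).deriv ▸ (hbc t ht).2⟩
  have hh : ∀ t x, deriv (fun τ => φ (τ, x)) t + deriv (fun ξ => deriv (fun ξ' => φ (t, ξ')) ξ) x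
      = φt t x + φxx t x := fun t x => by
    simp_rw [fun ξ => (dx t ξ).deriv, (dxx t x).deriv, (dt t x).deriv]
  simp_rw [hh]
  have slice : ∀ t, Continuous fun x => φ (t, x) := fun t => cφ.comp (Continuous.prodMk_right t)
  have lhs := hasSum_integral_integral_greenNeumann_mul hL hsr.le y
    (h := fun t x => φt t x + φxx t x) (ct.add cxx)
  have hsT : s ∈ Icc 0 T := ⟨hs, hsr.le.trans hrT⟩
  have rhs := (hasSum_integral_greenNeumann_mul hL (sub_pos.2 hsr) y (slice r)).sub
    (hasSum_cosine_series hL (slice s) (summable_integral_cos_mul hL (dx s) (dxx s)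
      (cxx.comp (Continuous.prodMk_right s)) (hbc' s hsT).1 (hbc' s hsT).2) hy)
  refine lhs.unique (rhs.congr_fun fun n => ?_)
  rw [integral_exp_mul_integral_cos_mul hL n hsr.le (φ := fun t x => φ (t, x))
    (φx := fun t x => ψ (t, x)) cφ ct cxx dt dx dxx
    fun t ht => hbc' t ⟨hs.trans ht.1, ht.2.trans hrT⟩]
  ring
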